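/- For any partition α with at most n parts and any positive integer b, the product of the complete homogeneous symmetric polynomial h_b and the Schur polynomial s_α in n variables equals the sum of Schur polynomials s_β over all partitions β with at most n parts such that β contains α, |β| = |α| + b, and β/α is a horizontal strip (i.e., β_i ≥ α_i ≥ β_{i+1} for all i). -/

import Mathlib

open MvPolynomial

/-- Complete homogeneous symmetric polynomial in `n` variables, indexed by an
integer, with the convention `h_k = 0` for `k < 0` and `h_0 = 1`. -/
noncomputable def hInt (n : ℕ) (k : ℤ) : MvPolynomial (Fin n) ℤ :=
  if 0 ≤ k then hsymm (Fin n) ℤ k.toNat else 0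

/-- The Schur polynomial of `α` in `n` variables, defined via the
Jacobi–Trudi determinant `s_α = det (h_{α_i - i + j})_{i,j}`. -/
noncomputable def schur (n : ℕ) (α : Fin n → ℕ) : MvPolynomial (Fin n) ℤ :=
  Matrix.det (Matrix.of fun i j : Fin n => hInt n ((α i : ℤ) - (i : ℕ) + (j : ℕ)))

/-- A symmetric polynomial is Schur positive if it is a nonnegative integer
combination of Schur polynomials of partitions. -/
def SchurPositive (n : ℕ) (f : MvPolynomial (Fin n) ℤ) : Prop :=
  ∃ c : (Fin n → ℕ) →₀ ℕ, (∀ lam ∈ c.support, Antitone lam) ∧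
    f = c.sum fun lam k => (k : ℤ) • schur n lam

open Finset in
/-- `h_b` is the sum of all monomials of degree `b`. -/
theorem hsymm_eq_sum_piAntidiag (σ R : Type*) [CommSemiring R] [Fintype σ] [DecidableEq σ]
    (b : ℕ) :
    hsymm σ R b = ∑ μ ∈ piAntidiag univ b, ∏ i, (X i : MvPolynomial σ R) ^ μ i := by
  let _ : Fintype {P : σ → ℕ // ∑ i, P i = b} :=
    Fintype.ofEquiv _ (Sym.equivNatSumOfFintype σ b)
  have hsub : ∑ μ ∈ piAntidiag univ b, ∏ i, (X i : MvPolynomial σ R) ^ μ i =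
      ∑ P : {P : σ → ℕ // ∑ i, P i = b}, ∏ i, (X i : MvPolynomial σ R) ^ P.1 i :=
    sum_subtype _ (by simp) _
  rw [hsub, hsymm]
  refine Fintype.sum_equiv (Sym.equivNatSumOfFintype σ b) _ _ fun s => ?_
  simp only [Sym.coe_equivNatSumOfFintype_apply_apply]
  exact prod_multiset_map_count _ _ |>.trans (prod_subset (subset_univ _) (by simp_all))

theorem PowerSeries.mk_pow_mul_one_sub {R : Type*} [CommRing R] (a : R) :
    (PowerSeries.mk fun k => a ^ k) * (1 - PowerSeries.C a * PowerSeries.X) = 1 := by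
  ext k
  rw [mul_sub, mul_one, map_sub, mul_left_comm, PowerSeries.coeff_C_mul]
  cases k with
  | zero => simp
  | succ k => simp [PowerSeries.coeff_succ_mul_X, pow_succ', PowerSeries.coeff_one]

open Finset in
/-- The generating function of the `h_k` is the product of the geometric series in the variables. -/
theorem mk_hsymm_eq_prod (σ R : Type*) [CommRing R] [Fintype σ] [DecidableEq σ] :
    PowerSeries.mk (hsymm σ R) =
      ∏ i, PowerSeries.mk fun k => (X i : MvPolynomial σ R) ^ k := by
  ext1 b
  rw [PowerSeries.coeff_prod, PowerSeries.coeff_mk, hsymm_eq_sum_piAntidiag]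
  simp only [PowerSeries.coeff_mk]
  refine sum_nbij' (fun μ => Finsupp.equivFunOnFinite.symm μ) (fun l => ⇑l) ?_ ?_ ?_ ?_ ?_
  · simp
  · simp
  · simp
  · intro a _; ext; simp
  · simp

open Finset in
/-- The polynomial `∏_{i ≠ l} (1 - x_i t)` in `t`. -/
noncomputable def prodOneSubErase (n : ℕ) (l : Fin n) : Polynomial (MvPolynomial (Fin n) ℤ) :=
  ∏ i ∈ univ.erase l, (1 - Polynomial.C (X i) * Polynomial.X)

open Finset in
theorem natDegree_prodOneSubErase_lt (n : ℕ) (l : Fin n) :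
    (prodOneSubErase n l).natDegree < n := by
  have hn : 0 < n := l.pos
  have h := Polynomial.natDegree_prod_le (univ.erase l)
    fun i : Fin n => (1 - Polynomial.C (X i : MvPolynomial (Fin n) ℤ) * Polynomial.X)
  have h2 : ∑ i ∈ univ.erase l, (1 - Polynomial.C (X i : MvPolynomial (Fin n) ℤ) *
      Polynomial.X).natDegree ≤ ∑ i ∈ univ.erase l, 1 := by
    refine sum_le_sum fun i _ => ?_
    compute_degree
  simp only [sum_const, card_erase_of_mem (mem_univ l), card_univ, Fintype.card_fin,
    smul_eq_mul, mul_one] at h2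
  have h3 : (prodOneSubErase n l).natDegree ≤ n - 1 := h.trans h2
  omega

open Finset in
theorem mk_hsymm_mul_prodOneSubErase (n : ℕ) (l : Fin n) :
    PowerSeries.mk (hsymm (Fin n) ℤ) * (prodOneSubErase n l : PowerSeries _) =
      PowerSeries.mk fun k => X l ^ k := by
  have hp : (prodOneSubErase n l : PowerSeries (MvPolynomial (Fin n) ℤ)) =
      ∏ i ∈ univ.erase l, (1 - PowerSeries.C (X i) * PowerSeries.X) := by
    rw [prodOneSubErase, ← Polynomial.coeToPowerSeries.ringHom_apply, map_prod]
    simp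
  rw [hp, mk_hsymm_eq_prod, ← mul_prod_erase univ _ (mem_univ l), mul_assoc, ← prod_mul_distrib]
  simp [PowerSeries.mk_pow_mul_one_sub]

open Finset in
theorem sum_coeff_mul_hInt (n N : ℕ) (l : Fin n) :
    ∑ r ∈ range n, hInt n ((N : ℤ) - (r : ℕ)) * (prodOneSubErase n l).coeff r = X l ^ N := by
  have h := congrArg (PowerSeries.coeff N) (mk_hsymm_mul_prodOneSubErase n l)
  rw [mul_comm, PowerSeries.coeff_mul, PowerSeries.coeff_mk,
    Finset.Nat.sum_antidiagonal_eq_sum_range_succ_mk] at h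
  simp only [Polynomial.coeff_coe, PowerSeries.coeff_mk] at h
  rw [← h, sum_subset (range_subset_range.2 (Nat.le_add_right n (N + 1))),
    ← sum_subset (range_subset_range.2 (Nat.le_add_left (N + 1) n))]
  · refine sum_congr rfl fun r hr => ?_
    have hr : r ≤ N := by simpa [Nat.lt_succ_iff] using hr
    rw [hInt, if_pos (by omega), mul_comm]
    congr 2
    omega
  · intro r _ hr
    rw [hInt, if_neg (by simp at hr; omega), zero_mul]
  · intro r _ hr
    rw [Polynomial.coeff_eq_zero_of_natDegree_lt, mul_zero]
    have := natDegree_prodOneSubErase_lt n l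
    simp at hr
    omega

/-- The alternant `a_γ = det (x_l ^ γ_i)`. -/
noncomputable def alternant (n : ℕ) (γ : Fin n → ℕ) : MvPolynomial (Fin n) ℤ :=
  Matrix.det (Matrix.of fun i l : Fin n => X l ^ γ i)

/-- The determinant relating Schur polynomials to alternants. -/
noncomputable def alternantDenominator (n : ℕ) : MvPolynomial (Fin n) ℤ :=
  Matrix.det (Matrix.of fun j l : Fin n => (prodOneSubErase n l).coeff (j.rev : ℕ))

open Finset in
theorem schur_mul_alternantDenominator (n : ℕ) (α : Fin n → ℕ) :
    schur n α * alternantDenominator n = alternant n fun i => α i + i.rev := by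
  rw [schur, alternantDenominator, ← Matrix.det_mul, alternant]
  congr 1
  ext1 i l
  rw [Matrix.mul_apply, Matrix.of_apply, ← sum_coeff_mul_hInt, ← Fin.sum_univ_eq_sum_range
    (fun r : ℕ => hInt n (((α i + (i.rev : ℕ) : ℕ) : ℤ) - r) * (prodOneSubErase n l).coeff r),
    ← Equiv.sum_comp Fin.revPerm]
  refine sum_congr rfl fun j _ => ?_
  simp only [Matrix.of_apply, Fin.revPerm_apply, Fin.rev_rev]
  congr 2
  simp only [Fin.val_rev]
  omega

theorem alternant_comp_perm (n : ℕ) (γ : Fin n → ℕ) (τ : Equiv.Perm (Fin n)) :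
    alternant n (γ ∘ τ) = (Equiv.Perm.sign τ : ℤ) • alternant n γ := by
  have := Matrix.det_permute τ (Matrix.of fun i l : Fin n => (X l : MvPolynomial (Fin n) ℤ) ^ γ i)
  rw [zsmul_eq_mul]
  exact this

theorem alternantDenominator_ne_zero (n : ℕ) : alternantDenominator n ≠ 0 := by
  intro h
  have h0 := schur_mul_alternantDenominator n 0
  have hrev := alternant_comp_perm n (fun i => i) Fin.revPerm
  have hv : alternant n (fun i => i) ≠ 0 := by
    have : alternant n (fun i => i) =
        (Matrix.vandermonde (X : Fin n → MvPolynomial (Fin n) ℤ)).det := by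
      rw [← Matrix.det_transpose]; rfl
    rw [this, Matrix.det_vandermonde_ne_zero_iff]
    exact X_injective
  have he : (fun i : Fin n => (0 : Fin n → ℕ) i + (i.rev : ℕ)) =
      (fun i : Fin n => (i : ℕ)) ∘ Fin.revPerm := by
    ext; simp
  rw [h, mul_zero, he, hrev, eq_comm, smul_eq_zero] at h0
  exact h0.elim (by simp) hv

open Finset in
theorem hsymm_mul_alternant (n b : ℕ) (γ : Fin n → ℕ) :
    hsymm (Fin n) ℤ b * alternant n γ = ∑ μ ∈ piAntidiag univ b, alternant n (γ + μ) := by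
  simp only [alternant, Matrix.det_apply, Matrix.of_apply, mul_sum]
  rw [sum_comm]
  refine sum_congr rfl fun τ _ => ?_
  rw [mul_smul_comm, ← smul_sum, hsymm_eq_sum_piAntidiag, sum_mul]
  congr 1
  refine sum_nbij' (fun μ => μ ∘ τ.symm) (fun μ => μ ∘ τ) ?_ ?_ ?_ ?_ ?_
  · intro μ hμ
    simpa [Equiv.sum_comp τ.symm μ] using hμ
  · intro μ hμ
    simpa [Equiv.sum_comp τ μ] using hμ
  · intro μ _; ext; simp
  · intro μ _; ext; simp
  · intro μ _
    simp [pow_add, prod_mul_distrib, mul_comm]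

/-- The predecessor of `j` in `Fin n`, truncated at zero. -/
def finPred {n : ℕ} (j : Fin n) : Fin n := ⟨j - 1, by omega⟩

/-- The positions `j > 0` at which `γ + μ` reaches the preceding entry of `γ`. -/
def overlaps {n : ℕ} (γ μ : Fin n → ℕ) : Finset (Fin n) :=
  {j | 0 < (j : ℕ) ∧ γ (finPred j) ≤ γ j + μ j}

theorem mem_overlaps {n : ℕ} {γ μ : Fin n → ℕ} {j : Fin n} :
    j ∈ overlaps γ μ ↔ 0 < (j : ℕ) ∧ γ (finPred j) ≤ γ j + μ j := by
  simp [overlaps]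

/-- The sequence whose sum with `γ` is `γ + μ` with the entries at `j` and its predecessor
exchanged. -/
def exchange {n : ℕ} (γ : Fin n → ℕ) (j : Fin n) (μ : Fin n → ℕ) : Fin n → ℕ :=
  (γ + μ) ∘ Equiv.swap (finPred j) j - γ

section exchange

variable {n : ℕ} {γ μ : Fin n → ℕ} {j : Fin n}

theorem finPred_le (j : Fin n) : finPred j ≤ j := Fin.le_def.2 (Nat.sub_le _ _)

theorem exchange_apply_of_lt {k : Fin n} (hk : j < k) : exchange γ j μ k = μ k := by
  simp [exchange, Equiv.swap_apply_of_ne_of_ne ((finPred_le j).trans_lt hk).ne' hk.ne']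

theorem add_exchange (hγ : Antitone γ) (hj : j ∈ overlaps γ μ) :
    γ + exchange γ j μ = (γ + μ) ∘ Equiv.swap (finPred j) j := by
  refine add_tsub_cancel_of_le fun k => ?_
  rw [mem_overlaps] at hj
  have := hγ (finPred_le j)
  rw [Function.comp_apply]
  rcases eq_or_ne k j with rfl | hkj
  · rw [Equiv.swap_apply_right]
    exact this.trans (Nat.le_add_right _ _)
  rcases eq_or_ne k (finPred j) with rfl | hkp
  · rw [Equiv.swap_apply_left]
    exact hj.2
  · rw [Equiv.swap_apply_of_ne_of_ne hkp hkj]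
    exact Nat.le_add_right _ _

theorem mem_overlaps_exchange (hγ : Antitone γ) (hj : j ∈ overlaps γ μ) :
    j ∈ overlaps γ (exchange γ j μ) := by
  have h := congrFun (add_exchange hγ hj) j
  rw [Function.comp_apply, Equiv.swap_apply_right, Pi.add_apply, Pi.add_apply] at h
  exact mem_overlaps.2 ⟨(mem_overlaps.1 hj).1, h ▸ Nat.le_add_right _ _⟩

theorem exchange_exchange (hγ : Antitone γ) (hj : j ∈ overlaps γ μ) :
    exchange γ j (exchange γ j μ) = μ := by
  refine add_left_cancel (a := γ) ?_
  rw [add_exchange hγ (mem_overlaps_exchange hγ hj), add_exchange hγ hj]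
  ext
  simp

theorem max'_overlaps_exchange (hγ : Antitone γ) (h : (overlaps γ μ).Nonempty)
    (h' : (overlaps γ (exchange γ ((overlaps γ μ).max' h) μ)).Nonempty) :
    (overlaps γ (exchange γ ((overlaps γ μ).max' h) μ)).max' h' = (overlaps γ μ).max' h := by
  refine le_antisymm (Finset.max'_le _ _ _ fun k hk => ?_)
    (Finset.le_max' _ _ (mem_overlaps_exchange hγ (Finset.max'_mem _ h)))
  by_contra! hlt
  rw [mem_overlaps, exchange_apply_of_lt hlt, ← mem_overlaps] at hk
  exact hlt.not_ge (Finset.le_max' _ _ hk)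

theorem sum_exchange (hγ : Antitone γ) (hj : j ∈ overlaps γ μ) :
    ∑ i, exchange γ j μ i = ∑ i, μ i := by
  have h := congrArg (fun f : Fin n → ℕ => ∑ i, f i) (add_exchange hγ hj)
  simp only [Function.comp_apply, Equiv.sum_comp (Equiv.swap (finPred j) j) (γ + μ)] at h
  simpa [Finset.sum_add_distrib] using h

theorem alternant_add_exchange (hγ : Antitone γ) (hj : j ∈ overlaps γ μ) :
    alternant n (γ + exchange γ j μ) = -alternant n (γ + μ) := by
  have hne : finPred j ≠ j := by
    have := (mem_overlaps.1 hj).1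
    simp only [finPred, ne_eq, Fin.ext_iff]
    omega
  rw [add_exchange hγ hj, alternant_comp_perm, Equiv.Perm.sign_swap hne]
  simp

end exchange

open Finset in
theorem sum_alternant_overlaps_nonempty (n b : ℕ) {γ : Fin n → ℕ} (hγ : Antitone γ) :
    ∑ μ ∈ piAntidiag univ b with (overlaps γ μ).Nonempty, alternant n (γ + μ) = 0 := by
  have hmem {μ} (hμ : μ ∈ (piAntidiag univ b).filter fun μ => (overlaps γ μ).Nonempty) :=
    max'_mem (overlaps γ μ) (mem_filter.1 hμ).2
  refine sum_involution
    (fun μ hμ => exchange γ ((overlaps γ μ).max' (mem_filter.1 hμ).2) μ) ?_ ?_ ?_ ?_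
  · intro μ hμ
    rw [alternant_add_exchange hγ (hmem hμ), add_neg_cancel]
  · intro μ hμ hne heq
    have h := alternant_add_exchange hγ (hmem hμ)
    rw [heq] at h
    exact hne (self_eq_neg.1 h)
  · intro μ hμ
    refine mem_filter.2 ⟨?_, _, mem_overlaps_exchange hγ (hmem hμ)⟩
    have := (mem_filter.1 hμ).1
    simp only [mem_piAntidiag, mem_univ, implies_true, and_true] at this ⊢
    rw [sum_exchange hγ (hmem hμ), this]
  · intro μ hμ
    simp only [max'_overlaps_exchange hγ (mem_filter.1 hμ).2]
    exact exchange_exchange hγ (hmem hμ)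

open Finset in
theorem hsymm_mul_alternant_of_antitone (n b : ℕ) {γ : Fin n → ℕ} (hγ : Antitone γ) :
    hsymm (Fin n) ℤ b * alternant n γ =
      ∑ μ ∈ piAntidiag univ b with ¬(overlaps γ μ).Nonempty, alternant n (γ + μ) := by
  rw [hsymm_mul_alternant, ← sum_filter_add_sum_filter_not _ fun μ => (overlaps γ μ).Nonempty,
    sum_alternant_overlaps_nonempty n b hγ, zero_add]

theorem not_nonempty_overlaps_add_rev {n : ℕ} {α μ : Fin n → ℕ} :
    ¬(overlaps (fun i => α i + i.rev) μ).Nonempty ↔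
      ∀ i j : Fin n, (i : ℕ) + 1 = j → α j + μ j ≤ α i := by
  simp only [Finset.not_nonempty_iff_eq_empty, Finset.eq_empty_iff_forall_notMem, mem_overlaps,
    not_and, not_le, Fin.val_rev]
  constructor
  · intro h i j hij
    have hi : finPred j = i := Fin.ext (by simp [finPred]; omega)
    have := h j (by omega)
    rw [hi] at this
    omega
  · intro h j hj
    have hp : (finPred j : ℕ) + 1 = j := by simp [finPred]; omega
    have := h _ _ hp
    omega

/-- Pieri's rule: `h_b · s_α = Σ_β s_β`, the sum over partitions `β ⊇ α` with
`|β| = |α| + b` such that `β/α` is a horizontal strip. -/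
theorem pieri_rule_hsymm (n b : ℕ) (hb : 0 < b) (α : Fin n → ℕ) (hα : Antitone α) :
    hsymm (Fin n) ℤ b * schur n α =
    ∑ β ∈ Finset.univ.filter
        (fun β : Fin n → Fin ((∑ i, α i) + b + 1) =>
          (∀ i j : Fin n, i ≤ j → (β j : ℕ) ≤ (β i : ℕ)) ∧
          (∀ i : Fin n, α i ≤ (β i : ℕ)) ∧
          (∀ i j : Fin n, (i : ℕ) + 1 = (j : ℕ) → (β j : ℕ) ≤ α i) ∧
          (∑ i, (β i : ℕ)) = (∑ i, α i) + b),
      schur n (fun i => (β i : ℕ)) := by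
  refine mul_right_cancel₀ (alternantDenominator_ne_zero n) ?_
  have hγ : Antitone fun i : Fin n => α i + (i.rev : ℕ) := fun i j hij =>
    add_le_add (hα hij) (Fin.rev_le_rev.2 hij)
  rw [mul_assoc, schur_mul_alternantDenominator, hsymm_mul_alternant_of_antitone n b hγ,
    Finset.sum_mul]
  simp only [schur_mul_alternantDenominator, not_nonempty_overlaps_add_rev]
  symm
  refine Finset.sum_bij (fun β _ i => (β i : ℕ) - α i) ?_ ?_ ?_ ?_
  · intro β hβ
    obtain ⟨-, hle, hstrip, hsum⟩ := (Finset.mem_filter.1 hβ).2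
    simp only [Finset.mem_filter, Finset.mem_piAntidiag, Finset.mem_univ, implies_true, and_true]
    refine ⟨?_, fun i j hij => ?_⟩
    · rw [Finset.sum_tsub_distrib _ fun i _ => hle i, hsum, Nat.add_sub_cancel_left]
    · rw [Nat.add_sub_cancel' (hle j)]
      exact hstrip i j hij
  · intro β hβ β' hβ' h
    ext i
    have h1 := (Finset.mem_filter.1 hβ).2.2.1 i
    have h2 := (Finset.mem_filter.1 hβ').2.2.1 i
    have h3 : (β i : ℕ) - α i = (β' i : ℕ) - α i := congrFun h i
    omega
  · intro μ hμ
    simp only [Finset.mem_filter, Finset.mem_piAntidiag, Finset.mem_univ, implies_true,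
      and_true] at hμ
    obtain ⟨hsum, hstrip⟩ := hμ
    have hα_le (i) : α i ≤ ∑ i, α i :=
      Finset.single_le_sum_of_canonicallyOrdered (Finset.mem_univ i)
    have hμ_le (i) : μ i ≤ b :=
      (Finset.single_le_sum_of_canonicallyOrdered (Finset.mem_univ i)).trans_eq hsum
    refine ⟨fun i => ⟨α i + μ i, ?_⟩, ?_, ?_⟩
    · have := hα_le i
      have := hμ_le i
      omega
    · simp only [Finset.mem_filter, Finset.mem_univ, true_and]
      refine ⟨fun i j hij => ?_, fun i => Nat.le_add_right _ _, hstrip, ?_⟩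
      · rcases hij.eq_or_lt with rfl | hlt
        · exact le_rfl
        · have hp : (finPred j : ℕ) + 1 = j := by simp [finPred]; omega
          have := hstrip _ _ hp
          have : α (finPred j) ≤ α i := hα (Fin.le_def.2 (by omega))
          omega
      · rw [Finset.sum_add_distrib, hsum]
    · ext i
      simp
  · intro β hβ
    congr 1
    ext i
    have := (Finset.mem_filter.1 hβ).2.2.1 i
    simp only [Pi.add_apply]
    omega
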